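/- Let A, B be real symmetric n×n matrices and α₁,…,α_m, β₁,…,β_m ∈ ℝ^n. Suppose that for every subset S ⊆ {1,…,m} with |S| ≤ 2, the matrices A + (Σ_{i∈S} α_i)(Σ_{i∈S} α_i)^T and B + (Σ_{i∈S} β_i)(Σ_{i∈S} β_i)^T are similar. Then there exists an orthogonal matrix Q such that Q^T A Q = B and Q^T α_i = β_i for all i = 1,…,m. -/

import Mathlib

open Matrix

/-- Two finite families with equal Gram matrices are related by an orthogonal matrix. -/
theorem gram_aux {ι κ : Type*} [Fintype ι] [DecidableEq ι] [Fintype κ] (a b : κ → ι → ℝ)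
    (h : ∀ i j, a i ⬝ᵥ a j = b i ⬝ᵥ b j) :
    ∃ R : Matrix ι ι ℝ, Rᵀ * R = 1 ∧ ∀ i, R *ᵥ a i = b i := by
  classical
  let a' : κ → EuclideanSpace ℝ ι := fun i => WithLp.toLp 2 (a i)
  let b' : κ → EuclideanSpace ℝ ι := fun i => WithLp.toLp 2 (b i)
  have hab : ∀ i j, inner ℝ (a' i) (a' j) = inner ℝ (b' i) (b' j) := by
    intro i j
    have := h j i
    simpa [a', b', EuclideanSpace.inner_eq_star_dotProduct] using this
  let f : (κ → ℝ) →ₗ[ℝ] EuclideanSpace ℝ ι := Fintype.linearCombination ℝ a'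
  let g : (κ → ℝ) →ₗ[ℝ] EuclideanSpace ℝ ι := Fintype.linearCombination ℝ b'
  have hfg : ∀ x, ‖f x‖ = ‖g x‖ := by
    intro x
    have : inner ℝ (f x) (f x) = inner ℝ (g x) (g x) := by
      simp only [f, g, Fintype.linearCombination_apply, sum_inner, inner_sum, inner_smul_left,
        inner_smul_right, hab]
    rw [real_inner_self_eq_norm_sq, real_inner_self_eq_norm_sq] at this
    exact (sq_eq_sq₀ (norm_nonneg _) (norm_nonneg _)).1 this
  obtain ⟨s, hs⟩ := f.rangeRestrict.exists_rightInverse_of_surjective f.range_rangeRestrict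
  have hs' : ∀ y, f (s y) = y := fun y => by
    have := LinearMap.congr_fun hs y
    exact congrArg Subtype.val this
  let L : LinearMap.range f →ₗᵢ[ℝ] EuclideanSpace ℝ ι :=
    { toLinearMap := g ∘ₗ s
      norm_map' := fun y => by
        have h1 : ‖(g ∘ₗ s) y‖ = ‖g (s y)‖ := rfl
        rw [h1, ← hfg, hs']; rfl }
  have hL : ∀ x, L ⟨f x, x, rfl⟩ = g x := by
    intro x
    change g (s _) = g x
    rw [← sub_eq_zero, ← map_sub, ← norm_eq_zero, ← hfg, map_sub, hs', sub_self, norm_zero]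
  have hfs : ∀ i, f (Pi.single i 1) = a' i := fun i => by simp [f]
  have hgs : ∀ i, g (Pi.single i 1) = b' i := fun i => by simp [g]
  have hT : ∀ i, L.extend (a' i) = b' i := by
    intro i
    rw [← hfs, ← hgs, ← hL]
    exact L.extend_apply ⟨f _, _, rfl⟩
  let R : Matrix ι ι ℝ := (Matrix.toEuclideanLin (𝕜 := ℝ)).symm L.extend.toLinearMap
  have hR : ∀ v : EuclideanSpace ℝ ι, R *ᵥ v.ofLp = (L.extend v).ofLp := by
    intro v
    have : Matrix.toEuclideanLin R v = L.extend v := by simp [R]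
    rw [← this]; rfl
  refine ⟨R, ?_, fun i => ?_⟩
  · ext i j
    have h1 := L.extend.inner_map_map (EuclideanSpace.single i (1:ℝ)) (EuclideanSpace.single j 1)
    rw [EuclideanSpace.inner_eq_star_dotProduct, ← hR, ← hR] at h1
    simp [dotProduct] at h1
    simp only [Matrix.mul_apply, Matrix.transpose_apply, Matrix.one_apply]
    rw [Finset.sum_congr rfl fun x _ => mul_comm (R x i) (R x j), h1,
      EuclideanSpace.inner_eq_star_dotProduct]
    by_cases hij : i = j
    · subst hij; simp
    · simp [hij, Ne.symm hij]
  · have := hR (a' i)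
    rw [hT] at this
    exact this

/-- Gluing the fibrewise orthogonal matrices. -/
theorem glue_aux {n m : ℕ} (d : Fin n → ℝ) (a b : Fin m → Fin n → ℝ)
    (h : ∀ y i j, ∑ k with d k = y, a i k * a j k = ∑ k with d k = y, b i k * b j k) :
    ∃ R : Matrix (Fin n) (Fin n) ℝ, Rᵀ * R = 1 ∧ R * diagonal d = diagonal d * R ∧
      ∀ i, R *ᵥ a i = b i := by
  classical
  have H : ∀ y : ℝ, ∃ R : Matrix {k // d k = y} {k // d k = y} ℝ, Rᵀ * R = 1 ∧
      ∀ i, R *ᵥ (fun k : {k // d k = y} => a i k) = (fun k : {k // d k = y} => b i k) := by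
    intro y
    apply gram_aux
    intro i j
    have := h y i j
    rw [Finset.sum_subtype (p := fun k => d k = y) _ (by simp),
      Finset.sum_subtype (p := fun k => d k = y) _ (by simp)] at this
    exact this
  choose R hR hRab using H
  let Q : Matrix (Fin n) (Fin n) ℝ := fun k l =>
    if hl : d l = d k then R (d k) ⟨k, rfl⟩ ⟨l, hl⟩ else 0
  have hQ : ∀ y k l (hk : d k = y) (hl : d l = y), Q k l = R y ⟨k, hk⟩ ⟨l, hl⟩ := by
    intro y k l hk hl
    subst hk
    simp [Q, hl]
  have hQ0 : ∀ k l, d l ≠ d k → Q k l = 0 := fun k l hkl => by simp [Q, hkl]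
  refine ⟨Q, ?_, ?_, ?_⟩
  · ext l l'
    simp only [Matrix.mul_apply, Matrix.transpose_apply]
    by_cases hl : d l' = d l
    · have h1 := congrFun (congrFun (hR (d l)) ⟨l, rfl⟩) ⟨l', hl⟩
      simp only [Matrix.mul_apply, Matrix.transpose_apply, Matrix.one_apply, Subtype.mk.injEq] at h1
      rw [Matrix.one_apply, ← h1,
        ← Finset.sum_filter_of_ne (p := fun k => d k = d l)
          (fun k _ hk => by
            by_contra hne
            exact hk (by rw [hQ0 k l (Ne.symm hne), zero_mul])),
        Finset.sum_subtype (p := fun k => d k = d l) _ (by simp)]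
      refine Finset.sum_congr rfl fun k _ => ?_
      rw [hQ (d l) k l k.2 rfl, hQ (d l) k l' k.2 hl]
    · rw [Matrix.one_apply_ne (fun e => hl (by rw [e]))]
      refine Finset.sum_eq_zero fun k _ => ?_
      by_cases hk : d l = d k
      · rw [hQ0 k l' (fun e => hl (e.trans hk.symm)), mul_zero]
      · rw [hQ0 k l hk, zero_mul]
  · ext k l
    rw [Matrix.mul_diagonal, Matrix.diagonal_mul]
    by_cases hk : d l = d k
    · rw [hk, mul_comm]
    · rw [hQ0 k l hk]; simp
  · intro i
    ext k
    have h1 := congrFun (hRab (d k) i) ⟨k, rfl⟩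
    simp only [Matrix.mulVec, dotProduct] at h1 ⊢
    rw [← h1, ← Finset.sum_filter_of_ne (p := fun l => d l = d k)
          (fun l _ hl => by
            by_contra hne
            exact hl (by rw [hQ0 k l hne, zero_mul])),
        Finset.sum_subtype (p := fun l => d l = d k) _ (by simp)]
    exact Finset.sum_congr rfl fun l _ => by rw [hQ (d k) k l rfl l.2]

theorem charpoly_eval_aux {n : ℕ} (d u : Fin n → ℝ) (x : ℝ) (hx : ∀ k, x - d k ≠ 0) :
    (diagonal d + vecMulVec u u).charpoly.eval x =
      (∏ k, (x - d k)) * (1 - ∑ k, u k ^ 2 / (x - d k)) := by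
  have hdet : (diagonal fun k => x - d k).det = ∏ k, (x - d k) := det_diagonal
  have e : scalar (Fin n) x - (diagonal d + vecMulVec u u) =
      (diagonal fun k => x - d k) *
        (1 + replicateCol Unit (fun k => - u k / (x - d k)) * replicateRow Unit u) := by
    ext i j
    rw [Matrix.diagonal_mul]
    simp only [Matrix.sub_apply, Matrix.add_apply, Matrix.scalar_apply, Matrix.diagonal_apply,
      vecMulVec_apply, Matrix.one_apply, Matrix.mul_apply, replicateCol_apply, replicateRow_apply,
      Finset.univ_unique, Finset.sum_singleton]
    have := hx i
    split_ifs with hij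
    · field_simp
      ring
    · field_simp
      ring
  rw [Matrix.eval_charpoly, e, det_mul, hdet, det_one_add_replicateCol_mul_replicateRow]
  congr 1
  rw [sub_eq_add_neg, ← Finset.sum_neg_distrib]
  simp only [dotProduct]
  congr 1
  exact Finset.sum_congr rfl fun k _ => by ring

theorem residue_aux {n : ℕ} (d u v : Fin n → ℝ)
    (h : (diagonal d + vecMulVec u u).charpoly = (diagonal d + vecMulVec v v).charpoly) (y : ℝ) :
    ∑ k with d k = y, u k * u k = ∑ k with d k = y, v k * v k := by
  classical
  have hev : ∀ᶠ x in nhdsWithin y {y}ᶜ, ∀ k, x - d k ≠ 0 := by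
    rw [Filter.eventually_all]
    intro k
    by_cases hk : d k = y
    · filter_upwards [self_mem_nhdsWithin] with x hx
      rw [hk]; exact sub_ne_zero.2 hx
    · apply Filter.Eventually.filter_mono nhdsWithin_le_nhds
      have : ∀ᶠ x in nhds y, x ≠ d k := isOpen_ne.mem_nhds (Ne.symm hk)
      filter_upwards [this] with x hx using sub_ne_zero.2 hx
  have hz : ∀ᶠ x in nhdsWithin y {y}ᶜ,
      ∑ k, (u k ^ 2 - v k ^ 2) * ((x - y) / (x - d k)) = 0 := by
    filter_upwards [hev] with x hx
    have h1 := charpoly_eval_aux d u x hx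
    rw [h, charpoly_eval_aux d v x hx] at h1
    have h2 := mul_left_cancel₀ (Finset.prod_ne_zero_iff.2 fun k _ => hx k) h1
    have h3 : ∑ k, (u k ^ 2 - v k ^ 2) * ((x - y) / (x - d k)) =
        (x - y) * (∑ k, u k ^ 2 / (x - d k) - ∑ k, v k ^ 2 / (x - d k)) := by
      rw [← Finset.sum_sub_distrib, Finset.mul_sum]
      exact Finset.sum_congr rfl fun k _ => by ring
    rw [h3]
    have : ∑ k, u k ^ 2 / (x - d k) - ∑ k, v k ^ 2 / (x - d k) = 0 := by linarith
    rw [this, mul_zero]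
  have hlim : Filter.Tendsto (fun x => ∑ k, (u k ^ 2 - v k ^ 2) * ((x - y) / (x - d k)))
      (nhdsWithin y {y}ᶜ) (nhds (∑ k, (u k ^ 2 - v k ^ 2) * (if d k = y then 1 else 0))) := by
    refine tendsto_finsetSum _ fun k _ => Filter.Tendsto.const_mul _ ?_
    split_ifs with hk
    · refine tendsto_const_nhds.congr' ?_
      filter_upwards [self_mem_nhdsWithin] with x hx
      rw [hk, div_self (sub_ne_zero.2 hx)]
    · have : ContinuousAt (fun x => (x - y) / (x - d k)) y :=
        ContinuousAt.div (by fun_prop) (by fun_prop) (sub_ne_zero.2 (Ne.symm hk))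
      have h2 := this.tendsto.mono_left (nhdsWithin_le_nhds (s := {y}ᶜ))
      simpa using h2
  have h0 := tendsto_nhds_unique (hlim.congr' hz) tendsto_const_nhds
  simp only [mul_ite, mul_one, mul_zero] at h0
  rw [← Finset.sum_filter, Finset.sum_sub_distrib] at h0
  simp only [← pow_two]
  linarith

theorem conj_aux {n : ℕ} (U D : Matrix (Fin n) (Fin n) ℝ) (hU : Uᵀ * U = 1) (x : Fin n → ℝ) :
    (U * D * Uᵀ + vecMulVec x x).charpoly = (D + vecMulVec (Uᵀ *ᵥ x) (Uᵀ *ᵥ x)).charpoly := by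
  have hU' : U * Uᵀ = 1 := mul_eq_one_comm.1 hU
  have e : U * D * Uᵀ + vecMulVec x x = U * ((D + vecMulVec (Uᵀ *ᵥ x) (Uᵀ *ᵥ x)) * Uᵀ) := by
    have h1 : vecMulVec (Uᵀ *ᵥ x) (Uᵀ *ᵥ x) = Uᵀ * vecMulVec x x * U := by
      rw [Matrix.mul_vecMulVec, Matrix.vecMulVec_mul, Matrix.mulVec_transpose]
    rw [h1]
    calc U * D * Uᵀ + vecMulVec x x = U * D * Uᵀ + (U * Uᵀ) * vecMulVec x x * (U * Uᵀ) := by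
          rw [hU']; simp
      _ = _ := by noncomm_ring
  rw [e, charpoly_mul_comm, Matrix.mul_assoc, hU, Matrix.mul_one]

theorem spectral_aux {n : ℕ} (A : Matrix (Fin n) (Fin n) ℝ) (hA : A.IsHermitian) :
    ∃ U : Matrix (Fin n) (Fin n) ℝ, Uᵀ * U = 1 ∧ A = U * diagonal hA.eigenvalues * Uᵀ := by
  refine ⟨hA.eigenvectorUnitary, ?_, ?_⟩
  · have := Unitary.coe_star_mul_self hA.eigenvectorUnitary
    simpa [Matrix.star_eq_conjTranspose] using this
  · have := hA.spectral_theorem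
    rw [Unitary.conjStarAlgAut_apply] at this
    simpa [Matrix.star_eq_conjTranspose, Function.comp_def] using this

theorem stmt_11 (n m : ℕ) (A B : Matrix (Fin n) (Fin n) ℝ)
    (hA : A.IsSymm) (hB : B.IsSymm)
    (α β : Fin m → Fin n → ℝ)
    (h : ∀ S : Finset (Fin m), S.card ≤ 2 →
      (A + Matrix.vecMulVec (∑ i ∈ S, α i) (∑ i ∈ S, α i)).charpoly =
      (B + Matrix.vecMulVec (∑ i ∈ S, β i) (∑ i ∈ S, β i)).charpoly) :
    ∃ Q : Matrix (Fin n) (Fin n) ℝ, Qᵀ * Q = 1 ∧ Qᵀ * A * Q = B ∧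
      ∀ i, Qᵀ.mulVec (α i) = β i := by
  have hA' : A.IsHermitian := by
    rw [Matrix.IsHermitian, Matrix.conjTranspose_eq_transpose_of_trivial]; exact hA
  have hB' : B.IsHermitian := by
    rw [Matrix.IsHermitian, Matrix.conjTranspose_eq_transpose_of_trivial]; exact hB
  have h0 : A.charpoly = B.charpoly := by simpa using h ∅ (by simp)
  have hd := (Matrix.IsHermitian.eigenvalues_eq_eigenvalues_iff hA' hB').2 h0
  obtain ⟨U, hU, hAU⟩ := spectral_aux A hA'
  obtain ⟨V, hV, hBV⟩ := spectral_aux B hB'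
  rw [← hd] at hBV
  generalize hA'.eigenvalues = d at hAU hBV
  have hV' : V * Vᵀ = 1 := mul_eq_one_comm.1 hV
  have hU' : U * Uᵀ = 1 := mul_eq_one_comm.1 hU
  have hS : ∀ S : Finset (Fin m), S.card ≤ 2 → ∀ y,
      ∑ k with d k = y, (Uᵀ *ᵥ (∑ i ∈ S, α i)) k * (Uᵀ *ᵥ (∑ i ∈ S, α i)) k =
      ∑ k with d k = y, (Vᵀ *ᵥ (∑ i ∈ S, β i)) k * (Vᵀ *ᵥ (∑ i ∈ S, β i)) k := by
    intro S hS y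
    apply residue_aux
    have := h S hS
    rwa [hAU, hBV, conj_aux U _ hU, conj_aux V _ hV] at this
  have h1 : ∀ y i, ∑ k with d k = y, (Uᵀ *ᵥ α i) k * (Uᵀ *ᵥ α i) k =
      ∑ k with d k = y, (Vᵀ *ᵥ β i) k * (Vᵀ *ᵥ β i) k := by
    intro y i
    simpa using hS {i} (by simp) y
  obtain ⟨R, hR, hRD, hRab⟩ := glue_aux d (fun i => Uᵀ *ᵥ α i) (fun i => Vᵀ *ᵥ β i) (by
    intro y i j
    by_cases hij : i = j
    · subst hij; exact h1 y i
    · have h2 := hS {i, j} Finset.card_le_two y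
      rw [Finset.sum_pair hij, Finset.sum_pair hij] at h2
      simp only [Matrix.mulVec_add, Pi.add_apply, add_mul, mul_add, Finset.sum_add_distrib] at h2
      rw [h1 y i, h1 y j] at h2
      have c1 := Finset.sum_congr (rfl : (Finset.univ.filter fun k => d k = y) = _)
        fun k _ => mul_comm ((Uᵀ *ᵥ α i) k) ((Uᵀ *ᵥ α j) k)
      have c2 := Finset.sum_congr (rfl : (Finset.univ.filter fun k => d k = y) = _)
        fun k _ => mul_comm ((Vᵀ *ᵥ β i) k) ((Vᵀ *ᵥ β j) k)
      linarith)
  have hR' : R * Rᵀ = 1 := mul_eq_one_comm.1 hR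
  refine ⟨U * Rᵀ * Vᵀ, ?_, ?_, fun i => ?_⟩
  · simp only [Matrix.transpose_mul, Matrix.transpose_transpose]
    calc V * (R * Uᵀ) * (U * Rᵀ * Vᵀ) = V * (R * (Uᵀ * U) * Rᵀ) * Vᵀ := by noncomm_ring
      _ = 1 := by rw [hU, Matrix.mul_one, hR', Matrix.mul_one, hV']
  · simp only [Matrix.transpose_mul, Matrix.transpose_transpose]
    rw [hAU, hBV]
    calc V * (R * Uᵀ) * (U * diagonal d * Uᵀ) * (U * Rᵀ * Vᵀ)
        = V * (R * (Uᵀ * U) * diagonal d * (Uᵀ * U) * Rᵀ) * Vᵀ := by noncomm_ring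
      _ = V * (diagonal d * (R * Rᵀ)) * Vᵀ := by
        rw [hU, Matrix.mul_one, Matrix.mul_one, hRD]
        simp only [Matrix.mul_assoc]
      _ = _ := by rw [hR', Matrix.mul_one]
  · simp only [Matrix.transpose_mul, Matrix.transpose_transpose]
    rw [← Matrix.mulVec_mulVec, ← Matrix.mulVec_mulVec, hRab, Matrix.mulVec_mulVec, hV',
      Matrix.one_mulVec]
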